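/- Let V be a graded subspace of k[x_1,...,x_n] over a field k of characteristic p, let m = p^a be a power of p, and let V^m = {f^m : f ∈ V}. If the quotient k[x_1,...,x_n]/⟨V⟩ has Hilbert series h(z), then the quotient k[x_1,...,x_n]/⟨V^m⟩ has Hilbert series h(z^m)·((1-z^m)/(1-z))^n. -/

import Mathlib

open MvPolynomial

theorem Submodule.finrank_pi_univ {K ι : Type*} [Field K] [Fintype ι] {M : ι → Type*}
    [∀ i, AddCommGroup (M i)] [∀ i, Module K (M i)] (U : ∀ i, Submodule K (M i))
    [∀ i, FiniteDimensional K (U i)] :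
    Module.finrank K (Submodule.pi Set.univ U) = ∑ i, Module.finrank K (U i) := by
  rw [← Module.finrank_pi_fintype K]
  exact LinearEquiv.finrank_eq
    { toFun := fun x i => ⟨x.1 i, x.2 i trivial⟩
      invFun := fun y => ⟨fun i => (y i).1, fun i _ => (y i).2⟩
      map_add' := fun _ _ => rfl
      map_smul' := fun _ _ => rfl
      left_inv := fun _ => rfl
      right_inv := fun _ => rfl }

namespace MvPolynomial

theorem isHomogeneous_iff_degree {σ R : Type*} [CommSemiring R] {f : MvPolynomial σ R} {i : ℕ} :
    f.IsHomogeneous i ↔ ∀ d : σ →₀ ℕ, coeff d f ≠ 0 → d.degree = i := by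
  rw [Finsupp.degree_eq_weight_one]
  rfl

instance finiteDimensional_homogeneousSubmodule {σ K : Type*} [Finite σ] [Field K] (i : ℕ) :
    FiniteDimensional K (homogeneousSubmodule σ K i) :=
  Module.Finite.iff_fg.mpr (homogeneousSubmodule_fg σ K i)

instance finiteDimensional_homogeneousSubmodule_inf {σ K : Type*} [Finite σ] [Field K] (i : ℕ)
    (W : Submodule K (MvPolynomial σ K)) :
    FiniteDimensional K (homogeneousSubmodule σ K i ⊓ W : Submodule K (MvPolynomial σ K)) :=
  Submodule.finiteDimensional_of_le inf_le_left

section ResidueComponent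

variable {σ R : Type*} [Finite σ] [CommSemiring R] {m : ℕ}

/-- The exponent vector with entries the chosen residues modulo `m`. -/
noncomputable def residueExponent (r : σ → Fin m) : σ →₀ ℕ :=
  Finsupp.equivFunOnFinite.symm fun i => (r i : ℕ)

@[simp]
theorem residueExponent_apply (r : σ → Fin m) (i : σ) : residueExponent r i = r i := rfl

theorem smul_add_residueExponent_inj {r s : σ → Fin m} {d e : σ →₀ ℕ}
    (h : m • d + residueExponent r = m • e + residueExponent s) : d = e ∧ r = s := by
  have key (i : σ) : d i = e i ∧ r i = s i := by
    have hi : m * d i + r i = m * e i + s i := by simpa using DFunLike.congr_fun h i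
    have hm : 0 < m := (r i).pos
    have h1 := congrArg (· / m) hi
    have h2 := congrArg (· % m) hi
    simp only [Nat.mul_add_div hm, Nat.div_eq_of_lt (r i).is_lt, Nat.div_eq_of_lt (s i).is_lt,
      add_zero, Nat.mul_add_mod, Nat.mod_eq_of_lt (r i).is_lt,
      Nat.mod_eq_of_lt (s i).is_lt] at h1 h2
    exact ⟨h1, Fin.ext h2⟩
  refine ⟨Finsupp.ext fun i => (key i).1, ?_⟩
  ext i : 1
  exact (key i).2

theorem exists_smul_add_residueExponent (hm : 0 < m) (d : σ →₀ ℕ) :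
    ∃ (e : σ →₀ ℕ) (r : σ → Fin m), d = m • e + residueExponent r := by
  refine ⟨Finsupp.equivFunOnFinite.symm fun i => d i / m, fun i => ⟨d i % m, Nat.mod_lt _ hm⟩, ?_⟩
  ext i
  simp [Nat.div_add_mod]

/-- The coordinate of a polynomial at the monomial with exponents `r`, in the basis of the
polynomial ring over its subring of polynomials in the `m`-th powers of the variables. -/
noncomputable def residueComponent (r : σ → Fin m) : MvPolynomial σ R →ₗ[R] MvPolynomial σ R :=
  (AddMonoidAlgebra.coeffLinearEquiv R).symm.toLinearMap ∘ₗ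
    Finsupp.lcomapDomain (fun d : σ →₀ ℕ => m • d + residueExponent r)
      (fun _ _ h => (smul_add_residueExponent_inj h).1) ∘ₗ
    (AddMonoidAlgebra.coeffLinearEquiv R).toLinearMap

@[simp]
theorem coeff_residueComponent (r : σ → Fin m) (f : MvPolynomial σ R) (d : σ →₀ ℕ) :
    coeff d (residueComponent r f) = coeff (m • d + residueExponent r) f := rfl

theorem ext_residueComponent (hm : 0 < m) {f g : MvPolynomial σ R}
    (h : ∀ r : σ → Fin m, residueComponent r f = residueComponent r g) : f = g := by
  ext d
  obtain ⟨e, r, rfl⟩ := exists_smul_add_residueExponent hm d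
  rw [← coeff_residueComponent, h, coeff_residueComponent]

theorem residueComponent_expand_mul (r : σ → Fin m) (g f : MvPolynomial σ R) :
    residueComponent r (expand m g * f) = g * residueComponent r f := by
  induction g using induction_on' with
  | add p q hp hq => simp only [map_add, add_mul, hp, hq]
  | monomial d b =>
    ext e
    have hle : m • d ≤ m • e + residueExponent r ↔ d ≤ e := by
      refine ⟨fun h i => ?_, fun h => (nsmul_le_nsmul_right h m).trans le_self_add⟩
      have hi : m * d i ≤ m * e i + r i := by simpa using h i
      have hr := (r i).is_lt
      by_contra! hlt
      have := Nat.mul_le_mul_left m (Nat.succ_le_of_lt hlt)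
      rw [Nat.mul_succ] at this
      omega
    rw [coeff_residueComponent, expand_monomial, coeff_monomial_mul', coeff_monomial_mul']
    simp only [hle, coeff_residueComponent]
    split_ifs with h
    · obtain ⟨c, rfl⟩ := le_iff_exists_add.mp h
      congr 2
      rw [add_tsub_cancel_left, smul_add, add_assoc, add_tsub_cancel_left]
    · rfl

theorem residueComponent_monomial [DecidableEq (σ → Fin m)] (r s : σ → Fin m) :
    residueComponent r (monomial (residueExponent s) (1 : R)) = if r = s then 1 else 0 := by
  classical
  ext d
  rw [coeff_residueComponent, coeff_monomial]
  by_cases h : residueExponent s = m • d + residueExponent r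
  · obtain ⟨rfl, rfl⟩ := smul_add_residueExponent_inj (d := 0) (by simpa using h)
    simp
  · rw [if_neg h]
    split_ifs with hrs
    · subst hrs
      rw [coeff_one, if_neg]
      rintro rfl
      simp at h
    · simp

theorem residueComponent_sum [DecidableEq σ] [Fintype σ] (g : (σ → Fin m) → MvPolynomial σ R) (r : σ → Fin m) :
    residueComponent r (∑ s, expand m (g s) * monomial (residueExponent s) 1) = g r := by
  classical
  simp [residueComponent_expand_mul, residueComponent_monomial]

theorem sum_residueComponent [DecidableEq σ] [Fintype σ] (hm : 0 < m) (f : MvPolynomial σ R) :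
    ∑ s : σ → Fin m, expand m (residueComponent s f) * monomial (residueExponent s) 1 = f :=
  ext_residueComponent hm fun r => residueComponent_sum (residueComponent · f) r

/-- A polynomial is determined by its residue components, which are arbitrary. -/
noncomputable def residueEquiv [DecidableEq σ] [Fintype σ] (hm : 0 < m) :
    MvPolynomial σ R ≃ₗ[R] ((σ → Fin m) → MvPolynomial σ R) :=
  LinearEquiv.ofBijective (LinearMap.pi residueComponent)
    ⟨fun _ _ h => ext_residueComponent hm (congrFun h),
      fun g => ⟨∑ s, expand m (g s) * monomial (residueExponent s) 1, by
        ext r : 1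
        exact residueComponent_sum g r⟩⟩

theorem mem_map_expand_iff [DecidableEq σ] [Fintype σ] (hm : 0 < m) {I : Ideal (MvPolynomial σ R)}
    {f : MvPolynomial σ R} :
    f ∈ I.map (expand m) ↔ ∀ r : σ → Fin m, residueComponent r f ∈ I := by
  constructor
  · intro hf r
    obtain ⟨N, c, v, rfl⟩ := Submodule.mem_span_set'.mp hf
    rw [map_sum]
    refine sum_mem fun j _ => ?_
    obtain ⟨g, hg, hv⟩ := (v j).2
    rw [← hv, smul_eq_mul, mul_comm]
    exact (residueComponent_expand_mul r g (c j)).symm ▸ I.mul_mem_right _ hg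
  · intro h
    rw [← sum_residueComponent hm f]
    exact sum_mem fun r _ => Ideal.mul_mem_right _ _ (Ideal.mem_map_of_mem _ (h r))

theorem isHomogeneous_iff_residueComponent (hm : 0 < m) {f : MvPolynomial σ R} {i : ℕ} :
    f.IsHomogeneous i ↔ ∀ (r : σ → Fin m) (d : σ →₀ ℕ), coeff d (residueComponent r f) ≠ 0 →
      m * d.degree + (residueExponent r).degree = i := by
  rw [isHomogeneous_iff_degree]
  constructor
  · intro h r d hd
    simpa using h _ hd
  · intro h d hd
    obtain ⟨e, r, rfl⟩ := exists_smul_add_residueExponent hm d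
    simpa using h r e hd

end ResidueComponent

theorem finrank_homogeneous_inf_map_expand {σ K : Type*} [DecidableEq σ] [Fintype σ] [Field K] {m : ℕ}
    (hm : 0 < m) (I : Ideal (MvPolynomial σ K)) (i : ℕ) :
    Module.finrank K (homogeneousSubmodule σ K i ⊓ (I.map (expand m)).restrictScalars K :
        Submodule K (MvPolynomial σ K)) =
      ∑ r : σ → Fin m, if (residueExponent r).degree ≤ i ∧ m ∣ i - (residueExponent r).degree then
        Module.finrank K (homogeneousSubmodule σ K ((i - (residueExponent r).degree) / m) ⊓
          I.restrictScalars K : Submodule K (MvPolynomial σ K)) else 0 := by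
  classical
  let U (r : σ → Fin m) : Submodule K (MvPolynomial σ K) :=
    if (residueExponent r).degree ≤ i ∧ m ∣ i - (residueExponent r).degree then
      homogeneousSubmodule σ K ((i - (residueExponent r).degree) / m) ⊓ I.restrictScalars K else ⊥
  have hpos (r : σ → Fin m) (h : (residueExponent r).degree ≤ i ∧
      m ∣ i - (residueExponent r).degree) : U r =
      homogeneousSubmodule σ K ((i - (residueExponent r).degree) / m) ⊓ I.restrictScalars K :=
    if_pos h
  have hneg (r : σ → Fin m) (h : ¬((residueExponent r).degree ≤ i ∧
      m ∣ i - (residueExponent r).degree)) : U r = ⊥ := if_neg h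
  have hfin (r : σ → Fin m) : FiniteDimensional K (U r) := by
    by_cases h : (residueExponent r).degree ≤ i ∧ m ∣ i - (residueExponent r).degree
    · rw [hpos r h]
      infer_instance
    · rw [hneg r h]
      infer_instance
  have hU (r : σ → Fin m) (g : MvPolynomial σ K) : g ∈ U r ↔ (∀ d : σ →₀ ℕ, coeff d g ≠ 0 →
      m * d.degree + (residueExponent r).degree = i) ∧ g ∈ I := by
    by_cases h : (residueExponent r).degree ≤ i ∧ m ∣ i - (residueExponent r).degree
    · rw [hpos r h]
      obtain ⟨hle, c, hc⟩ := h
      rw [Submodule.mem_inf, mem_homogeneousSubmodule, isHomogeneous_iff_degree, hc,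
        Nat.mul_div_cancel_left _ hm, Submodule.restrictScalars_mem]
      refine and_congr_left' (forall₂_congr fun d _ => ?_)
      constructor
      · rintro rfl
        omega
      · intro hd
        exact Nat.eq_of_mul_eq_mul_left hm (by omega)
    · rw [hneg r h, Submodule.mem_bot]
      constructor
      · rintro rfl
        simp
      · rintro ⟨hg, -⟩
        ext d
        by_contra hd
        have := hg d hd
        exact h ⟨by omega, d.degree, by omega⟩
  have hmap : (homogeneousSubmodule σ K i ⊓ (I.map (expand m)).restrictScalars K :
      Submodule K (MvPolynomial σ K)).map (residueEquiv hm).toLinearMap =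
        Submodule.pi Set.univ U := by
    ext g
    obtain ⟨f, rfl⟩ := (residueEquiv hm).surjective g
    have hinj : residueEquiv hm f ∈ (homogeneousSubmodule σ K i ⊓
        (I.map (expand m)).restrictScalars K :
        Submodule K (MvPolynomial σ K)).map (residueEquiv hm).toLinearMap ↔
        f ∈ (homogeneousSubmodule σ K i ⊓ (I.map (expand m)).restrictScalars K :
          Submodule K (MvPolynomial σ K)) :=
      Iff.trans (Submodule.mem_map_equiv _) (by rw [LinearEquiv.symm_apply_apply])
    rw [hinj, Submodule.mem_inf, mem_homogeneousSubmodule, Submodule.restrictScalars_mem,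
      mem_map_expand_iff hm, isHomogeneous_iff_residueComponent hm, ← forall_and]
    simp only [Submodule.mem_pi, Set.mem_univ, true_implies, hU]
    exact Iff.rfl
  rw [← LinearEquiv.finrank_map_eq (residueEquiv hm), hmap, Submodule.finrank_pi_univ]
  refine Finset.sum_congr rfl fun r _ => ?_
  split_ifs with h
  · rw [hpos r h]
  · rw [hneg r h, finrank_bot]

section BaseChange

variable {σ K L : Type*} [Field K] [Field L]

theorem linearIndependent_map {ι : Type*} (φ : K →+* L) {v : ι → MvPolynomial σ K}
    (hv : LinearIndependent K v) : LinearIndependent L fun j => map φ (v j) := by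
  algebraize [φ]
  have := (Module.Flat.linearIndependent_one_tmul (S := L) hv).map'
    (algebraTensorAlgEquiv (σ := σ) K L).toLinearMap (LinearEquiv.ker _)
  have hv' : (fun j => map φ (v j)) = (algebraTensorAlgEquiv (σ := σ) K L).toLinearMap ∘
      fun j => TensorProduct.tmul K (1 : L) (v j) := by
    funext j
    simp [RingHom.algebraMap_toAlgebra]
  rw [hv']
  exact this

theorem finrank_span_image_map (φ : K →+* L) (W : Submodule K (MvPolynomial σ K))
    [FiniteDimensional K W] :
    Module.finrank L (Submodule.span L (map φ '' (W : Set (MvPolynomial σ K)))) =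
      Module.finrank K W := by
  let b := Module.finBasis K W
  have hli := linearIndependent_map φ (b.linearIndependent.map' W.subtype W.ker_subtype)
  have hspan : Submodule.span L (map φ '' (W : Set (MvPolynomial σ K))) =
      Submodule.span L (Set.range fun j => map φ (W.subtype (b j))) := by
    apply le_antisymm
    · rw [Submodule.span_le]
      rintro _ ⟨w, hw, rfl⟩
      have := congrArg (fun x : W => map φ (x : MvPolynomial σ K)) (b.sum_repr ⟨w, hw⟩)
      simp only [AddSubmonoidClass.coe_finsetSum, Submodule.coe_smul, map_sum, smul_eq_C_mul,
        map_mul, map_C] at this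
      rw [← this]
      refine sum_mem fun j _ => ?_
      rw [← smul_eq_C_mul]
      exact Submodule.smul_mem _ _ (Submodule.subset_span ⟨j, rfl⟩)
    · refine Submodule.span_mono ?_
      rintro _ ⟨j, rfl⟩
      exact ⟨_, (b j).2, rfl⟩
  rw [hspan]
  exact (finrank_span_eq_card hli).trans (by simp)

theorem map_homogeneousComponent (φ : K →+* L) (i : ℕ) (f : MvPolynomial σ K) :
    homogeneousComponent i (map φ f) = map φ (homogeneousComponent i f) := by
  classical
  ext d
  simp only [coeff_homogeneousComponent, coeff_map]
  split_ifs <;> simp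

theorem mem_span_image_map_of_mem_ideal_map (φ : K →+* L) (I : Ideal (MvPolynomial σ K))
    {f : MvPolynomial σ L} (hf : f ∈ I.map (map φ)) :
    f ∈ Submodule.span L (map φ '' (I : Set (MvPolynomial σ K))) := by
  obtain ⟨N, c, v, rfl⟩ := Submodule.mem_span_set'.mp hf
  refine sum_mem fun j _ => ?_
  obtain ⟨g, hg, hv⟩ := (v j).2
  rw [← hv, smul_eq_mul]
  induction c j using induction_on' with
  | add p q hp hq => rw [add_mul]; exact add_mem hp hq
  | monomial d b =>
    have : monomial d b * map φ g = b • map φ (monomial d 1 * g) := by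
      rw [map_mul, map_monomial, map_one, ← smul_mul_assoc, smul_monomial, smul_eq_mul, mul_one]
    exact this ▸ Submodule.smul_mem _ _ (Submodule.subset_span ⟨_, I.mul_mem_left _ hg, rfl⟩)

theorem finrank_homogeneous_inf_ideal_map [Finite σ] (φ : K →+* L)
    (I : Ideal (MvPolynomial σ K)) (hI : ∀ f ∈ I, ∀ i, homogeneousComponent i f ∈ I) (i : ℕ) :
    Module.finrank L (homogeneousSubmodule σ L i ⊓ (I.map (map φ)).restrictScalars L :
        Submodule L (MvPolynomial σ L)) =
      Module.finrank K (homogeneousSubmodule σ K i ⊓ I.restrictScalars K :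
        Submodule K (MvPolynomial σ K)) := by
  rw [← finrank_span_image_map φ]
  suffices h : (homogeneousSubmodule σ L i ⊓ (I.map (map φ)).restrictScalars L :
      Submodule L (MvPolynomial σ L)) = Submodule.span L (map φ ''
        ((homogeneousSubmodule σ K i ⊓ I.restrictScalars K :
          Submodule K (MvPolynomial σ K)) : Set (MvPolynomial σ K))) by rw [h]
  apply le_antisymm
  · rintro f ⟨hf, hfI⟩
    rw [← homogeneousComponent_eq_self hf]
    have := Submodule.mem_map_of_mem (f := homogeneousComponent i)
      (mem_span_image_map_of_mem_ideal_map φ I hfI)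
    rw [Submodule.map_span] at this
    refine Submodule.span_mono ?_ this
    rintro _ ⟨_, ⟨g, hg, rfl⟩, rfl⟩
    exact ⟨homogeneousComponent i g, ⟨homogeneousComponent_mem i g, hI g hg i⟩,
      (map_homogeneousComponent φ i g).symm⟩
  · rw [Submodule.span_le]
    rintro _ ⟨g, ⟨hg, hgI⟩, rfl⟩
    exact ⟨IsHomogeneous.map hg φ, Ideal.mem_map_of_mem _ hgI⟩

end BaseChange

theorem homogeneousComponent_mem_span {σ R : Type*} [CommSemiring R]
    {S : Set (MvPolynomial σ R)} (hS : ∀ f ∈ S, ∀ i, homogeneousComponent i f ∈ S)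
    {f : MvPolynomial σ R} (hf : f ∈ Ideal.span S) (i : ℕ) :
    homogeneousComponent i f ∈ Ideal.span S := by
  let := gradedAlgebra (σ := σ) (R := R)
  refine homogeneousComponent_mem_of_mem ?_ hf i
  have : Ideal.span S = Ideal.span {g ∈ S | ∃ j, g ∈ homogeneousSubmodule σ R j} := by
    refine le_antisymm (Ideal.span_le.mpr fun g hg => ?_) (Ideal.span_mono fun g hg => hg.1)
    rw [SetLike.mem_coe, ← sum_homogeneousComponent g]
    exact sum_mem fun j _ =>
      Ideal.subset_span ⟨hS g hg j, j, homogeneousComponent_mem j g⟩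
  rw [this]
  exact Ideal.homogeneous_span _ _ fun g hg => hg.2

theorem span_image_pow_eq_map_map_expand {σ k : Type*} [Field k] (p a : ℕ) [Fact p.Prime] [CharP k p]
    (S : Set (MvPolynomial σ k)) :
    Ideal.span ((fun f => f ^ p ^ a) '' S) =
      ((Ideal.span S).map (map (iterateFrobenius k p a))).map (expand (p ^ a)) := by
  rw [Ideal.map_span, Ideal.map_span, ← Set.image_comp]
  congr 1
  refine Set.image_congr fun f _ => ?_
  rw [← map_iterateFrobenius_expand, map_expand]
  rfl

end MvPolynomial

theorem PowerSeries.coeff_mk_dvd_mul_geom_pow {n m : ℕ} (h : ℕ → ℕ) (i : ℕ) :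
    PowerSeries.coeff i ((PowerSeries.mk fun i => if m ∣ i then h (i / m) else 0)
        * (∑ j ∈ Finset.range m, (PowerSeries.X : PowerSeries ℕ) ^ j) ^ n) =
      ∑ r : Fin n → Fin m, if (residueExponent r).degree ≤ i ∧
        m ∣ i - (residueExponent r).degree then h ((i - (residueExponent r).degree) / m) else 0 := by
  have hpow : (∑ j ∈ Finset.range m, (PowerSeries.X : PowerSeries ℕ) ^ j) ^ n =
      ∑ r : Fin n → Fin m, PowerSeries.X ^ (residueExponent r).degree := by
    rw [Finset.sum_range, ← Fin.prod_const, Finset.prod_univ_sum, Fintype.piFinset_univ]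
    refine Finset.sum_congr rfl fun r _ => ?_
    rw [Finset.prod_pow_eq_pow_sum, Finsupp.degree_eq_sum]
    rfl
  rw [hpow, Finset.mul_sum, map_sum]
  refine Finset.sum_congr rfl fun r _ => ?_
  rw [PowerSeries.coeff_mul_X_pow', PowerSeries.coeff_mk, ite_and]

theorem stmt_12 {k : Type*} [Field k] {p n a : ℕ} [Fact p.Prime] [CharP k p]
    (m : ℕ) (hm : m = p ^ a)
    (V : Submodule k (MvPolynomial (Fin n) k))
    (hV : ∀ f ∈ V, ∀ i : ℕ, MvPolynomial.homogeneousComponent i f ∈ V)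
    (H : Ideal (MvPolynomial (Fin n) k) → ℕ → ℕ)
    (hH : ∀ I : Ideal (MvPolynomial (Fin n) k), ∀ i : ℕ,
      H I i = Module.finrank k (MvPolynomial.homogeneousSubmodule (Fin n) k i)
        - Module.finrank k
            ((MvPolynomial.homogeneousSubmodule (Fin n) k i ⊓
              Submodule.restrictScalars k I : Submodule k (MvPolynomial (Fin n) k)))) :
    (PowerSeries.mk fun i => (H (Ideal.span ((fun f => f ^ m) '' (V : Set (MvPolynomial (Fin n) k)))) i : ℕ))
      = (PowerSeries.mk fun i => if m ∣ i then H (Ideal.span (V : Set (MvPolynomial (Fin n) k))) (i / m) else 0)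
        * (∑ j ∈ Finset.range m, (PowerSeries.X : PowerSeries ℕ) ^ j) ^ n := by
  subst hm
  have hm : 0 < p ^ a := pow_pos (Fact.out : p.Prime).pos a
  ext i
  rw [PowerSeries.coeff_mk, PowerSeries.coeff_mk_dvd_mul_geom_pow, span_image_pow_eq_map_map_expand, hH]
  have htop := finrank_homogeneous_inf_map_expand hm (⊤ : Ideal (MvPolynomial (Fin n) k)) i
  rw [Ideal.map_top, Submodule.restrictScalars_top, inf_top_eq] at htop
  rw [htop, finrank_homogeneous_inf_map_expand hm]
  simp only [finrank_homogeneous_inf_ideal_map (iterateFrobenius k p a) _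
    (fun f hf j => homogeneousComponent_mem_span hV hf j)]
  rw [← Finset.sum_tsub_distrib]
  · refine Finset.sum_congr rfl fun r _ => ?_
    split_ifs
    · rw [hH, inf_top_eq]
    · rfl
  · intro r _
    split_ifs
    · exact Submodule.finrank_mono (inf_le_inf_left _ le_top)
    · rfl
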